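/- The regular elliptic isometry with angle pair {13π/18, 11π/18} is not a product of three holomorphic involutions: let A = diag(e^{5πi/18}, e^{πi/6}, e^{−4πi/9}), which satisfies Aᴴ J A = J and det A = 1. Then for all 3×3 complex matrices I₁, I₂, I₃ satisfying I_kᴴ J I_k = J and I_k · I_k = 1 (k = 1,2,3), and for every scalar λ ∈ ℂ, one has A ≠ λ · (I₁ I₂ I₃). (The angle pair (13π/18, 11π/18) lies in the interior of the forbidden triangle T with vertices (π,π), (2π/3,π/3), (π/2,π/2); this witnesses that the involution length of PU(2,1) is exactly 4.) -/

import Mathlib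

open Matrix

/-- The Hermitian form of signature (2,1) on ℂ³ (ball model). -/
noncomputable def Jball : Matrix (Fin 3) (Fin 3) ℂ := Matrix.diagonal ![1, 1, -1]

/-- Membership in U(2,1). -/
def InU21 (A : Matrix (Fin 3) (Fin 3) ℂ) : Prop := Aᴴ * Jball * A = Jball

/-- The Hermitian product of signature (2,1). -/
noncomputable def herm (u v : Fin 3 → ℂ) : ℂ :=
  star (u 0) * v 0 + star (u 1) * v 1 - star (u 2) * v 2

/-- The real number `⟨v, v⟩`. -/
noncomputable def hermNorm (v : Fin 3 → ℂ) : ℝ :=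
  Complex.normSq (v 0) + Complex.normSq (v 1) - Complex.normSq (v 2)

/-- The rank one operator `w ↦ r ⟨v, w⟩ v`. -/
noncomputable def rankOne (r : ℝ) (v : Fin 3 → ℂ) : Matrix (Fin 3) (Fin 3) ℂ :=
  Matrix.of fun i j => r * v i * star (v j) * (![1, 1, -1] : Fin 3 → ℂ) j

/-- The operator `-1 + 2 P`, with `P` the rank one operator given by `r` and `v`. -/
noncomputable def invol (r : ℝ) (v : Fin 3 → ℂ) : Matrix (Fin 3) (Fin 3) ℂ :=
  -1 + (2 : ℂ) • rankOne r v

theorem herm_self (v : Fin 3 → ℂ) : herm v v = hermNorm v := by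
  simp [herm, hermNorm, Complex.normSq_eq_conj_mul_self]

theorem rankOne_mulVec (r : ℝ) (v w : Fin 3 → ℂ) :
    rankOne r v *ᵥ w = (r * herm v w) • v := by
  ext i
  simp [rankOne, herm, Matrix.mulVec, dotProduct, Fin.sum_univ_three]
  ring

theorem invol_mulVec (r : ℝ) (v w : Fin 3 → ℂ) :
    invol r v *ᵥ w = -w + (2 * r * herm v w) • v := by
  simp [invol, Matrix.add_mulVec, Matrix.neg_mulVec, Matrix.smul_mulVec, rankOne_mulVec, smul_smul,
    mul_assoc]

theorem invol_mulVec_of_herm_eq_zero {v w : Fin 3 → ℂ} (h : herm v w = 0) (r : ℝ) :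
    invol r v *ᵥ w = -w := by
  simp [invol_mulVec, h]

theorem invol_zero (v : Fin 3 → ℂ) : invol 0 v = -1 := by
  ext i j
  simp [invol, rankOne]

theorem det_invol (r : ℝ) (v : Fin 3 → ℂ) :
    (invol r v).det = -1 + 2 * ((r * hermNorm v : ℝ) : ℂ) := by
  rw [Complex.ofReal_mul, ← herm_self]
  simp [invol, rankOne, herm, Matrix.det_fin_three]
  ring

theorem rankOne_mul_self (r : ℝ) (v : Fin 3 → ℂ) :
    rankOne r v * rankOne r v = ((r * hermNorm v : ℝ) : ℂ) • rankOne r v := by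
  rw [Complex.ofReal_mul, ← herm_self]
  ext i j
  simp [rankOne, herm, Matrix.mul_apply, Fin.sum_univ_three]
  ring

theorem adjugate_fin_three_eq (Q : Matrix (Fin 3) (Fin 3) ℂ) :
    Q.adjugate = Q * Q - Q.trace • Q + ((Q.trace ^ 2 - (Q * Q).trace) / 2) • 1 := by
  rw [Matrix.adjugate_fin_three]
  ext i j
  fin_cases i <;> fin_cases j <;>
    simp [Matrix.mul_apply, Matrix.trace_fin_three, Fin.sum_univ_three] <;> ring

theorem idempotent_cases {Q : Matrix (Fin 3) (Fin 3) ℂ} (hQ : Q * Q = Q) :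
    Q = 0 ∨ Q = 1 ∨ Q.trace = 1 ∨ Q.trace = 2 := by
  have h := Q.mul_adjugate
  rw [adjugate_fin_three_eq, hQ, mul_add, mul_sub, mul_smul_comm, mul_smul_comm, hQ, mul_one] at h
  have h' : ((Q.trace - 1) * (Q.trace - 2) / 2) • Q = Q.det • 1 := by
    rw [← h]; module
  by_cases ht : (Q.trace - 1) * (Q.trace - 2) / 2 = 0
  · right; right
    rcases mul_eq_zero.1 ((div_eq_zero_iff.1 ht).resolve_right two_ne_zero) with h | h
    · left; linear_combination h
    · right; linear_combination h
  · obtain ⟨q, hq⟩ : ∃ q : ℂ, Q = q • 1 := by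
      refine ⟨((Q.trace - 1) * (Q.trace - 2) / 2)⁻¹ * Q.det, ?_⟩
      rw [mul_smul, ← h', smul_smul, inv_mul_cancel₀ ht, one_smul]
    have hqq : q * q = q := by
      have := congrFun (congrFun hQ 0) 0
      rw [hq] at this
      simpa using this
    rcases mul_eq_zero.1 (show q * (q - 1) = 0 by linear_combination hqq) with h | h
    · left; rw [hq, h, zero_smul]
    · right; left; rw [hq, show q = 1 by linear_combination h, one_smul]

theorem exists_rankOne_of_trace_eq_one {Q : Matrix (Fin 3) (Fin 3) ℂ} (hQ : Q * Q = Q)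
    (hH : (Jball * Q)ᴴ = Jball * Q) (ht : Q.trace = 1) :
    ∃ (r : ℝ) (v : Fin 3 → ℂ), Q = rankOne r v ∧ r * hermNorm v = 1 := by
  have hadj : Q.adjugate = 0 := by
    rw [adjugate_fin_three_eq, hQ, ht]; simp
  rw [Matrix.adjugate_fin_three] at hadj
  have hs : ∀ i j, star (Q j i) * (![1, 1, -1] : Fin 3 → ℂ) j =
      (![1, 1, -1] : Fin 3 → ℂ) i * Q i j := by
    intro i j
    have := congrFun (congrFun hH i) j
    fin_cases i <;> fin_cases j <;> simpa [Jball, Matrix.diagonal_mul] using this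
  obtain ⟨i, hi⟩ : ∃ i, Q i i ≠ 0 := by
    by_contra! h
    simp [Matrix.trace_fin_three, h] at ht
  have hm : ∀ k l, Q k l * Q i i = Q k i * Q i l := by
    have e := fun k l => congrFun (congrFun hadj k) l
    have e00 := e 0 0
    have e01 := e 0 1
    have e02 := e 0 2
    have e10 := e 1 0
    have e11 := e 1 1
    have e12 := e 1 2
    have e20 := e 2 0
    have e21 := e 2 1
    have e22 := e 2 2
    simp at e00 e01 e02 e10 e11 e12 e20 e21 e22
    intro k l
    fin_cases i <;> fin_cases k <;> fin_cases l <;> simp <;> grind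
  have hreal : ((Q i i).re : ℂ) = Q i i := by
    have := hs i i
    apply Complex.conj_eq_iff_re.1
    fin_cases i <;> simpa using this
  have hQr : Q = rankOne ((Q i i).re⁻¹ * (![1, 1, -1] : Fin 3 → ℝ) i) (fun k => Q k i) := by
    ext k l
    have h1 := hs i l
    have h2 := hm k l
    simp only [rankOne, Matrix.of_apply]
    rw [mul_assoc, h1]
    push_cast
    rw [hreal]
    have : (((![1, 1, -1] : Fin 3 → ℝ) i : ℝ) : ℂ) * (![1, 1, -1] : Fin 3 → ℂ) i = 1 := by
      fin_cases i <;> simp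
    field_simp
    linear_combination h2 - Q k i * Q i l * this
  refine ⟨_, _, hQr, ?_⟩
  have h := rankOne_mul_self ((Q i i).re⁻¹ * (![1, 1, -1] : Fin 3 → ℝ) i) (fun k => Q k i)
  rw [← hQr, hQ] at h
  have h' := congrFun (congrFun h i) i
  rw [Matrix.smul_apply, smul_eq_mul] at h'
  exact Complex.ofReal_eq_one.1 (mul_right_cancel₀ hi (h'.symm.trans (one_mul _).symm))

theorem exists_invol {M : Matrix (Fin 3) (Fin 3) ℂ} (hM : InU21 M) (hM2 : M * M = 1) :
    ∃ (s : ℂ) (r : ℝ) (v : Fin 3 → ℂ), s ^ 2 = 1 ∧ M = s • invol r v ∧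
      (r = 0 ∨ r * hermNorm v = 1) := by
  have hJ : Jballᴴ = Jball := by
    ext i j; fin_cases i <;> fin_cases j <;> simp [Jball]
  have hH : (Jball * M)ᴴ = Jball * M := by
    rw [Matrix.conjTranspose_mul, hJ]
    calc Mᴴ * Jball = Mᴴ * Jball * (M * M) := by rw [hM2, mul_one]
      _ = Jball * M := by rw [← mul_assoc, show Mᴴ * Jball * M = Jball from hM]
  have key : ∀ N : Matrix (Fin 3) (Fin 3) ℂ, N * N = 1 → (Jball * N)ᴴ = Jball * N →
      ((2⁻¹ : ℂ) • (1 + N)).trace = 1 →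
      ∃ (r : ℝ) (v : Fin 3 → ℂ), N = invol r v ∧ (r = 0 ∨ r * hermNorm v = 1) := by
    intro N hN hNH ht
    obtain ⟨r, v, h, hr⟩ := exists_rankOne_of_trace_eq_one (Q := (2⁻¹ : ℂ) • (1 + N)) (by
        rw [smul_mul_smul_comm, add_mul, mul_add, mul_add, hN, mul_one, one_mul, mul_one]; module)
      (by
        rw [mul_smul_comm, mul_add, mul_one, Matrix.conjTranspose_smul, Matrix.conjTranspose_add,
          hNH, hJ]
        simp) ht
    refine ⟨r, v, ?_, Or.inr hr⟩
    rw [invol, ← h]; module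
  have hQ : ((2⁻¹ : ℂ) • (1 + M)) * ((2⁻¹ : ℂ) • (1 + M)) = (2⁻¹ : ℂ) • (1 + M) := by
    rw [smul_mul_smul_comm, add_mul, mul_add, mul_add, hM2, mul_one, one_mul, mul_one]; module
  rcases idempotent_cases hQ with h | h | h | h
  · refine ⟨1, 0, 0, by norm_num, ?_, Or.inl rfl⟩
    rw [invol_zero]
    have : M = (2 : ℂ) • ((2⁻¹ : ℂ) • (1 + M)) - 1 := by module
    rw [this, h]; simp
  · refine ⟨-1, 0, 0, by norm_num, ?_, Or.inl rfl⟩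
    rw [invol_zero]
    have : M = (2 : ℂ) • ((2⁻¹ : ℂ) • (1 + M)) - 1 := by module
    rw [this, h]; module
  · obtain ⟨r, v, h1, h2⟩ := key M hM2 hH h
    exact ⟨1, r, v, by norm_num, by rw [one_smul, h1], h2⟩
  · obtain ⟨r, v, h1, h2⟩ := key (-M) (by simpa using hM2)
      (by rw [mul_neg, Matrix.conjTranspose_neg, hH]) (by
        have : (2⁻¹ : ℂ) • (1 + -M) = 1 - (2⁻¹ : ℂ) • (1 + M) := by module
        rw [this, Matrix.trace_sub, h]; simp; norm_num)
    exact ⟨-1, r, v, by norm_num, by rw [← h1]; simp, h2⟩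

theorem exists_orthogonal (u v : Fin 3 → ℂ) : ∃ w ≠ 0, herm u w = 0 ∧ herm v w = 0 := by
  obtain ⟨w, hw, h⟩ := Matrix.exists_mulVec_eq_zero_iff.2
    (show (!![star (u 0), star (u 1), -star (u 2); star (v 0), star (v 1), -star (v 2); 0, 0, 0] :
      Matrix (Fin 3) (Fin 3) ℂ).det = 0 by simp [Matrix.det_fin_three])
  refine ⟨w, hw, ?_, ?_⟩
  · simpa [Matrix.mulVec, dotProduct, Fin.sum_univ_three, herm, sub_eq_add_neg] using congrFun h 0
  · simpa [Matrix.mulVec, dotProduct, Fin.sum_univ_three, herm, sub_eq_add_neg] using congrFun h 1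

theorem diagonal_eq_smul_invol_mul_invol {a : Fin 3 → ℂ} {c : ℂ} {r s : ℝ} {u v : Fin 3 → ℂ}
    (h : Matrix.diagonal a = c • (invol r u * invol s v)) : ∃ i, a i = c := by
  obtain ⟨w, hw, hu, hv⟩ := exists_orthogonal u v
  obtain ⟨i, hi⟩ := Function.ne_iff.1 hw
  refine ⟨i, mul_right_cancel₀ hi ?_⟩
  have := congrFun (congrArg (· *ᵥ w) h) i
  simpa [Matrix.mulVec_diagonal, Matrix.smul_mulVec, ← Matrix.mulVec_mulVec, Matrix.mulVec_neg,
    invol_mulVec_of_herm_eq_zero hu, invol_mulVec_of_herm_eq_zero hv] using this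

/-- The Gram determinant of three vectors has the sign of `det J`. -/
theorem reversed_cauchy_schwarz {u v w : Fin 3 → ℂ} (hu : herm u w = 0) (hv : herm v w = 0)
    (hw : 0 < hermNorm w) : hermNorm u * hermNorm v ≤ Complex.normSq (herm u v) := by
  have key : hermNorm w * (hermNorm u * hermNorm v - Complex.normSq (herm u v)) =
      -Complex.normSq (Matrix.det (Matrix.of ![u, v, w])) := by
    have hu' : herm w u = 0 := by
      have := congrArg star hu
      simp [herm] at this
      simp [herm]; linear_combination this
    have hv' : herm w v = 0 := by
      have := congrArg star hv
      simp [herm] at this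
      simp [herm]; linear_combination this
    have e : herm w w * (herm u u * herm v v - herm v u * herm u v) +
        herm u w * (herm v u * herm w v - herm v v * herm w u) +
        herm v w * (herm w u * herm u v - herm w v * herm u u) =
        -(star (Matrix.det (Matrix.of ![u, v, w])) * Matrix.det (Matrix.of ![u, v, w])) := by
      simp [herm, Matrix.det_fin_three]
      ring
    rw [hu, hv, zero_mul, zero_mul, add_zero, add_zero, herm_self, herm_self, herm_self,
      show herm v u = star (herm u v) by simp [herm]; ring] at e
    apply Complex.ofReal_injective
    push_cast
    rw [Complex.normSq_eq_conj_mul_self, Complex.normSq_eq_conj_mul_self]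
    exact e
  nlinarith [Complex.normSq_nonneg (Matrix.det (Matrix.of ![u, v, w]))]

theorem trace_invol_mul_invol (r s : ℝ) (u v : Fin 3 → ℂ) :
    (invol r u * invol s v).trace = ((3 - 2 * (r * hermNorm u) - 2 * (s * hermNorm v)
      + 4 * (r * s * Complex.normSq (herm u v)) : ℝ) : ℂ) := by
  push_cast
  rw [← herm_self, ← herm_self, Complex.normSq_eq_conj_mul_self]
  simp [invol, rankOne, herm, Matrix.mul_apply, Matrix.trace_fin_three, Fin.sum_univ_three]
  ring

theorem diagonal_eq_invol_prod {x y T : Fin 3 → ℝ} (hT : ∀ i, T i * (1 + x i) = y i)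
    (hxy : ∀ i, x i ^ 2 + y i ^ 2 = 1) (hx : ∀ i, 1 + x i ≠ 0)
    {r₁ r₂ r₃ : ℝ} {v₁ v₂ v₃ : Fin 3 → ℂ}
    (h₁ : r₁ * hermNorm v₁ = 1) (h₂ : r₂ * hermNorm v₂ = 1) (h₃ : r₃ * hermNorm v₃ = 1)
    (h : Matrix.diagonal (fun i => (x i + y i * Complex.I : ℂ)) =
      invol r₁ v₁ * invol r₂ v₂ * invol r₃ v₃) :
    ∃ p q s : ℝ, p + q + s = 1 ∧ p * T 0 + q * T 1 + s * T 2 = 0 ∧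
      (0 ≤ p ∧ 0 ≤ q ∧ s ≤ 0 ∨ p ≤ 0 ∧ q ≤ 0 ∧ 0 ≤ s ∧
        (p * (1 + T 0 ^ 2) + q * (1 + T 1 ^ 2) + s * (1 + T 2 ^ 2) < 0 →
          x 0 * (2 * p - 1) + x 1 * (2 * q - 1) + x 2 * (2 * s - 1) ≤ -1 ∨
          3 ≤ x 0 * (2 * p - 1) + x 1 * (2 * q - 1) + x 2 * (2 * s - 1))) := by
  have hsq : invol r₃ v₃ * invol r₃ v₃ = 1 := by
    have := rankOne_mul_self r₃ v₃
    rw [h₃, Complex.ofReal_one, one_smul] at this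
    rw [invol, add_mul, mul_add, mul_add, smul_mul_smul_comm, this]
    simp only [mul_neg, neg_mul, one_mul, mul_one, neg_neg]
    module
  have hB : Matrix.diagonal (fun i => (x i + y i * Complex.I : ℂ)) * invol r₃ v₃ =
      invol r₁ v₁ * invol r₂ v₂ := by
    rw [h, mul_assoc, hsq, mul_one]
  obtain ⟨w, hw, hw₁, hw₂⟩ := exists_orthogonal v₁ v₂
  set β : ℂ := 2 * r₃ * herm v₃ w with hβ
  have hTc : ∀ i, (1 + (x i + y i * Complex.I : ℂ)) * (1 + T i * Complex.I) =
      2 * (x i + y i * Complex.I) := by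
    intro i
    have h1 : (y i : ℂ) = T i * (1 + x i) := by exact_mod_cast (hT i).symm
    have h2 : (x i : ℂ) ^ 2 + (y i : ℂ) ^ 2 = 1 := by exact_mod_cast hxy i
    have h3 : (1 + x i : ℂ) ≠ 0 := by exact_mod_cast hx i
    apply mul_left_cancel₀ h3
    linear_combination (-(1 + x i) - y i * Complex.I) * Complex.I * h1 + y i ^ 2 * Complex.I_sq
      - h2
  have hb : ∀ i, (1 + (x i + y i * Complex.I : ℂ)) ≠ 0 := by
    intro i h0
    apply hx i
    simpa using congrArg Complex.re h0
  have hwi : ∀ i, 2 * w i = β * v₃ i * (1 + T i * Complex.I) := by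
    intro i
    have := congrFun (congrArg (· *ᵥ w) hB) i
    simp only [← Matrix.mulVec_mulVec, invol_mulVec_of_herm_eq_zero hw₁,
      invol_mulVec_of_herm_eq_zero hw₂, Matrix.mulVec_neg, invol_mulVec r₃,
      Matrix.mulVec_diagonal, neg_neg, Pi.add_apply, Pi.neg_apply, Pi.smul_apply, smul_eq_mul,
      ← hβ] at this
    apply mul_left_cancel₀ (hb i)
    linear_combination (-2) * this - β * v₃ i * hTc i
  have hβ0 : β ≠ 0 := by
    intro h0
    apply hw
    ext i
    simpa [h0] using hwi i
  have hN : hermNorm v₃ ≠ 0 := right_ne_zero_of_mul_eq_one h₃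
  set p := r₃ * Complex.normSq (v₃ 0) with hp
  set q := r₃ * Complex.normSq (v₃ 1) with hq
  set s := -(r₃ * Complex.normSq (v₃ 2)) with hs
  have hpc : (p : ℂ) = r₃ * (star (v₃ 0) * v₃ 0) := by
    simp [hp, Complex.normSq_eq_conj_mul_self]
  have hqc : (q : ℂ) = r₃ * (star (v₃ 1) * v₃ 1) := by
    simp [hq, Complex.normSq_eq_conj_mul_self]
  have hsc : (s : ℂ) = -(r₃ * (star (v₃ 2) * v₃ 2)) := by
    simp [hs, Complex.normSq_eq_conj_mul_self]
  have hsum : p + q + s = 1 := by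
    rw [← h₃, hermNorm, hp, hq, hs]; ring
  have hpT : (p * (1 + T 0 * Complex.I) + q * (1 + T 1 * Complex.I) + s * (1 + T 2 * Complex.I)
      : ℂ) = 1 := by
    apply mul_left_cancel₀ hβ0
    rw [hpc, hqc, hsc, mul_one]
    nth_rewrite 2 [hβ]
    rw [herm]
    linear_combination -r₃ * (star (v₃ 0) * hwi 0 + star (v₃ 1) * hwi 1 - star (v₃ 2) * hwi 2)
  refine ⟨p, q, s, hsum, by simpa using congrArg Complex.im hpT, ?_⟩
  rcases le_or_gt 0 r₃ with hr | hr
  · left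
    have e := fun i => mul_nonneg hr (Complex.normSq_nonneg (v₃ i))
    exact ⟨e 0, e 1, neg_nonpos.2 (e 2)⟩
  right
  have e := fun i => mul_nonpos_of_nonpos_of_nonneg hr.le (Complex.normSq_nonneg (v₃ i))
  refine ⟨e 0, e 1, neg_nonneg.2 (e 2), fun hneg => ?_⟩
  have hnorm : ∀ i, 4 * Complex.normSq (w i) =
      Complex.normSq β * Complex.normSq (v₃ i) * (1 + T i ^ 2) := by
    intro i
    have := congrArg Complex.normSq (hwi i)
    simp only [map_mul] at this
    rw [show Complex.normSq (1 + T i * Complex.I) = 1 + T i ^ 2 by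
      simp [Complex.normSq_apply]; ring] at this
    rw [← this]
    norm_num
  have hwpos : 0 < hermNorm w := by
    have e1 : 4 * (r₃ * hermNorm w) = Complex.normSq β *
        (p * (1 + T 0 ^ 2) + q * (1 + T 1 ^ 2) + s * (1 + T 2 ^ 2)) := by
      rw [hermNorm, hp, hq, hs]
      linear_combination r₃ * (hnorm 0 + hnorm 1 - hnorm 2)
    have e2 := mul_neg_of_pos_of_neg (Complex.normSq_pos.2 hβ0) hneg
    by_contra! hle
    nlinarith [mul_nonneg_of_nonpos_of_nonpos hr.le hle]
  have hcs := reversed_cauchy_schwarz hw₁ hw₂ hwpos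
  have htr := congrArg (fun M => (Matrix.trace M).re) hB
  simp only [trace_invol_mul_invol, Complex.ofReal_re, h₁, h₂] at htr
  have htr' : (Matrix.diagonal (fun i => (x i + y i * Complex.I : ℂ)) * invol r₃ v₃).trace =
      (x 0 + y 0 * Complex.I) * (2 * p - 1) + (x 1 + y 1 * Complex.I) * (2 * q - 1)
        + (x 2 + y 2 * Complex.I) * (2 * s - 1) := by
    rw [hpc, hqc, hsc]
    simp [invol, rankOne, Matrix.trace_fin_three, Matrix.diagonal_mul]
    ring
  rw [htr'] at htr
  simp at htr
  rw [htr]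
  set g := Complex.normSq (herm v₁ v₂)
  have hg : 0 ≤ g := Complex.normSq_nonneg _
  have hprod : r₁ * r₂ * (hermNorm v₁ * hermNorm v₂) = 1 := by
    linear_combination r₂ * hermNorm v₂ * h₁ + h₂
  rcases le_or_gt (r₁ * r₂) 0 with h0 | h0
  · left
    nlinarith [mul_nonneg_of_nonpos_of_nonpos h0 (neg_nonpos.2 hg)]
  · right
    nlinarith [mul_le_mul_of_nonneg_left hcs h0.le]

theorem not_weighted_zero {p q s T₀ T₁ T₂ : ℝ} (h₀ : 0 < T₀) (h₁ : 0 < T₁) (h₂ : T₂ < 0)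
    (hsum : p + q + s = 1) (hT : p * T₀ + q * T₁ + s * T₂ = 0)
    (h : 0 ≤ p ∧ 0 ≤ q ∧ s ≤ 0 ∨ p ≤ 0 ∧ q ≤ 0 ∧ 0 ≤ s) : False := by
  rcases h with ⟨hp, hq, hs⟩ | ⟨hp, hq, hs⟩
  · have e₀ := mul_nonneg hp h₀.le
    have e₁ := mul_nonneg hq h₁.le
    have e₂ := mul_nonneg_of_nonpos_of_nonpos hs h₂.le
    have hp0 := (mul_eq_zero.1 (show p * T₀ = 0 by linarith)).resolve_right h₀.ne'
    have hq0 := (mul_eq_zero.1 (show q * T₁ = 0 by linarith)).resolve_right h₁.ne'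
    linarith
  · have e₂ := mul_nonpos_of_nonneg_of_nonpos hs h₂.le
    have e₀ := mul_nonpos_of_nonpos_of_nonneg hp h₀.le
    have e₁ := mul_nonpos_of_nonpos_of_nonneg hq h₁.le
    have hs0 := (mul_eq_zero.1 (show s * T₂ = 0 by linarith)).resolve_right h₂.ne
    linarith

theorem cos_pi_div_nine_bounds :
    0.9396 < Real.cos (Real.pi / 9) ∧ Real.cos (Real.pi / 9) < 0.9397 := by
  have h3 : 4 * Real.cos (Real.pi / 9) ^ 3 - 3 * Real.cos (Real.pi / 9) = 1 / 2 := by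
    rw [← Real.cos_three_mul, ← Real.cos_pi_div_three]
    congr 1; ring
  have hlt : 1 / 2 < Real.cos (Real.pi / 9) := by
    rw [← Real.cos_pi_div_three]
    apply Real.cos_lt_cos_of_nonneg_of_le_pi <;> linarith [Real.pi_pos]
  set X := Real.cos (Real.pi / 9)
  constructor <;> by_contra! h <;>
    nlinarith [mul_nonneg (sub_nonneg.2 h) (sub_nonneg.2 hlt.le),
      mul_nonneg (mul_nonneg (sub_nonneg.2 h) (sub_nonneg.2 hlt.le)) (sub_nonneg.2 hlt.le)]

theorem tan_pi_div_nine_bounds {T : ℝ} (hT : T * (1 + Real.cos (2 * Real.pi / 9)) =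
    Real.sin (2 * Real.pi / 9)) : 0.363 < T ∧ T < 0.3645 := by
  obtain ⟨h1, h2⟩ := cos_pi_div_nine_bounds
  have hs : 0 < Real.sin (Real.pi / 9) :=
    Real.sin_pos_of_pos_of_lt_pi (by positivity) (by linarith [Real.pi_pos])
  have hsc := Real.sin_sq_add_cos_sq (Real.pi / 9)
  rw [show 2 * Real.pi / 9 = 2 * (Real.pi / 9) by ring, Real.cos_two_mul, Real.sin_two_mul] at hT
  set X := Real.cos (Real.pi / 9)
  set Y := Real.sin (Real.pi / 9)
  have hTX : T * X = Y := by
    apply mul_left_cancel₀ (show 2 * X ≠ 0 by positivity)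
    linear_combination hT
  have hT0 : 0 < T := by
    by_contra! h
    nlinarith
  have hTT : (T ^ 2 + 1) * X ^ 2 = 1 := by linear_combination hsc + (T * X + Y) * hTX
  constructor
  · by_contra! h
    have : T ^ 2 ≤ 0.363 ^ 2 := by gcongr
    have : X ^ 2 < 0.9397 ^ 2 := by gcongr
    nlinarith
  · by_contra! h
    have : 0.3645 ^ 2 ≤ T ^ 2 := by gcongr
    have : 0.9396 ^ 2 < X ^ 2 := by gcongr
    nlinarith

theorem tan_five_pi_div_twelve_bound {T : ℝ} (hT : T * (1 + -(√3 / 2)) = 1 / 2) : 3.7 < T := by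
  have h3 : (1.73 : ℝ) < √3 := by
    rw [Real.lt_sqrt (by norm_num)]; norm_num
  have h4 : √3 < (2 : ℝ) := by
    rw [Real.sqrt_lt' (by norm_num)]; norm_num
  by_contra! h
  nlinarith

theorem cot_pi_div_thirty_six_bound {T : ℝ}
    (hT : T * (1 + -Real.cos (Real.pi / 18)) = Real.sin (Real.pi / 18)) : 5 < T := by
  have hs : 0 < Real.sin (Real.pi / 18) :=
    Real.sin_pos_of_pos_of_lt_pi (by positivity) (by linarith [Real.pi_pos])
  have hs' : Real.sin (Real.pi / 18) < 0.18 := by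
    linarith [Real.sin_lt (show 0 < Real.pi / 18 by positivity), Real.pi_lt_d2]
  have hc : 0 < Real.cos (Real.pi / 18) :=
    Real.cos_pos_of_mem_Ioo ⟨by linarith [Real.pi_pos], by linarith [Real.pi_pos]⟩
  have hsc := Real.sin_sq_add_cos_sq (Real.pi / 18)
  set X := Real.cos (Real.pi / 18)
  set Y := Real.sin (Real.pi / 18)
  have : T * Y = 1 + X := by
    apply mul_left_cancel₀ hs.ne'
    linear_combination T * hsc + (1 + X) * hT
  by_contra! h
  nlinarith

theorem not_weighted_loxodromic {p q s T₀ T₁ T₂ C D : ℝ}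
    (hT₀ : 5 < T₀) (hT₁ : 3.7 < T₁) (hT₂ : 0.363 < T₂ ∧ T₂ < 0.3645) (hC : C ≤ 1) (hC0 : 0 < C)
    (hD : D < 0.7661) (hD0 : 0 < D)
    (hsum : p + q + s = 1) (hT : p * T₀ + q * T₁ + s * T₂ = 0)
    (h : 0 ≤ p ∧ 0 ≤ q ∧ s ≤ 0 ∨ p ≤ 0 ∧ q ≤ 0 ∧ 0 ≤ s ∧
        (p * (1 + T₀ ^ 2) + q * (1 + T₁ ^ 2) + s * (1 + T₂ ^ 2) < 0 →
          -C * (2 * p - 1) + -(√3 / 2) * (2 * q - 1) + D * (2 * s - 1) ≤ -1 ∨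
          3 ≤ -C * (2 * p - 1) + -(√3 / 2) * (2 * q - 1) + D * (2 * s - 1))) : False := by
  obtain ⟨hT₂, hT₂'⟩ := hT₂
  obtain rfl : s = 1 - p - q := by linarith
  rcases h with ⟨hp, hq, -⟩ | ⟨hp, hq, -, h⟩
  · nlinarith [mul_nonneg hp (show 0 ≤ T₀ - T₂ by linarith),
      mul_nonneg hq (show 0 ≤ T₁ - T₂ by linarith)]
  obtain ⟨a, rfl⟩ : ∃ a, p = -a := ⟨-p, by ring⟩
  obtain ⟨b, rfl⟩ : ∃ b, q = -b := ⟨-q, by ring⟩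
  have ha : 0 ≤ a := by linarith
  have hb : 0 ≤ b := by linarith
  have hlin : a * (T₀ - T₂) + b * (T₁ - T₂) = T₂ := by linear_combination -hT
  have hle : a * 4.6 + b * 3.33 ≤ 0.3645 := by
    nlinarith [mul_nonneg ha (show 0 ≤ T₀ - T₂ - 4.6 by linarith),
      mul_nonneg hb (show 0 ≤ T₁ - T₂ - 3.33 by linarith)]
  have h4 : √3 < (1.7321 : ℝ) := by
    rw [Real.sqrt_lt' (by norm_num)]; norm_num
  have h5 := Real.sqrt_nonneg 3
  have haC := mul_le_mul_of_nonneg_left hC ha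
  have haC' := mul_nonneg ha hC0.le
  have hbE := mul_le_mul_of_nonneg_left h4.le hb
  have hbE' := mul_nonneg hb h5
  have haD := mul_le_mul_of_nonneg_left hD.le ha
  have hbD := mul_le_mul_of_nonneg_left hD.le hb
  have haD' := mul_nonneg ha hD0.le
  have hbD' := mul_nonneg hb hD0.le
  have hneg : -a * (1 + T₀ ^ 2) + -b * (1 + T₁ ^ 2) + (1 - -a - -b) * (1 + T₂ ^ 2) < 0 := by
    have e₀ := mul_nonneg (mul_nonneg ha (show 0 ≤ T₀ - T₂ by linarith))
      (show 0 ≤ T₀ - 3.7 by linarith)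
    have e₁ := mul_nonneg (mul_nonneg hb (show 0 ≤ T₁ - T₂ by linarith))
      (show 0 ≤ T₁ - 3.7 by linarith)
    linear_combination e₀ + e₁ + 3.7 * hT₂ - (3.7 + T₂) * hlin
  rcases h hneg with h | h <;> nlinarith

theorem not_diagonal_eq_invol_prod {γ : ℝ} {r₁ r₂ r₃ : ℝ} {v₁ v₂ v₃ : Fin 3 → ℂ}
    (h₁ : r₁ * hermNorm v₁ = 1) (h₂ : r₂ * hermNorm v₂ = 1) (h₃ : r₃ * hermNorm v₃ = 1)
    (hγ : γ = 0 ∨ γ = 2 * Real.pi / 3 ∨ γ = 4 * Real.pi / 3) :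
    Matrix.diagonal (fun i => Complex.exp
      (((![5 * Real.pi / 18, Real.pi / 6, -(4 * Real.pi / 9)] : Fin 3 → ℝ) i - γ : ℝ) * Complex.I))
      ≠ invol r₁ v₁ * invol r₂ v₂ * invol r₃ v₃ := by
  intro h
  set φ : Fin 3 → ℝ := fun i =>
    (![5 * Real.pi / 18, Real.pi / 6, -(4 * Real.pi / 9)] : Fin 3 → ℝ) i - γ with hφ
  have hpos := Real.pi_pos
  have hxy : ∀ i, Real.cos (φ i) ^ 2 + Real.sin (φ i) ^ 2 = 1 := fun i =>
    Real.cos_sq_add_sin_sq _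
  have hx_of : ∀ i, Real.sin (φ i) ≠ 0 → 0 < 1 + Real.cos (φ i) := by
    intro i hi
    have := sq_pos_of_ne_zero hi
    nlinarith [hxy i, Real.neg_one_le_cos (φ i)]
  have main : (∀ i, Real.sin (φ i) ≠ 0) → _ := fun hy =>
    diagonal_eq_invol_prod (x := fun i => Real.cos (φ i)) (y := fun i => Real.sin (φ i))
      (T := fun i => Real.sin (φ i) / (1 + Real.cos (φ i)))
      (fun i => div_mul_cancel₀ _ (hx_of i (hy i)).ne') hxy (fun i => (hx_of i (hy i)).ne')
      h₁ h₂ h₃ (by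
        rw [← h]; congr 1; ext i
        rw [Complex.exp_mul_I, ← Complex.ofReal_cos, ← Complex.ofReal_sin])
  rcases hγ with rfl | rfl | rfl
  · have s0 : 0 < Real.sin (φ 0) := by
      apply Real.sin_pos_of_pos_of_lt_pi <;> simp [hφ] <;> linarith
    have s1 : 0 < Real.sin (φ 1) := by
      apply Real.sin_pos_of_pos_of_lt_pi <;> simp [hφ] <;> linarith
    have s2 : Real.sin (φ 2) < 0 := by
      apply Real.sin_neg_of_neg_of_neg_pi_lt <;> simp [hφ] <;> linarith
    obtain ⟨p, q, s, hsum, hT, hc⟩ := main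
      (by intro i; fin_cases i; exacts [s0.ne', s1.ne', s2.ne])
    exact not_weighted_zero (div_pos s0 (hx_of 0 s0.ne')) (div_pos s1 (hx_of 1 s1.ne'))
      (div_neg_of_neg_of_pos s2 (hx_of 2 s2.ne)) hsum hT (by tauto)
  · have s0 : Real.sin (φ 0) < 0 := by
      apply Real.sin_neg_of_neg_of_neg_pi_lt <;> simp [hφ] <;> linarith
    have s1 : Real.sin (φ 1) < 0 := by
      apply Real.sin_neg_of_neg_of_neg_pi_lt <;> simp [hφ] <;> linarith
    have s2 : 0 < Real.sin (φ 2) := by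
      rw [← Real.sin_add_two_pi]
      apply Real.sin_pos_of_pos_of_lt_pi <;> simp [hφ] <;> linarith
    obtain ⟨p, q, s, hsum, hT, hc⟩ := main
      (by intro i; fin_cases i; exacts [s0.ne, s1.ne, s2.ne'])
    exact not_weighted_zero (neg_pos.2 (div_neg_of_neg_of_pos s0 (hx_of 0 s0.ne)))
      (neg_pos.2 (div_neg_of_neg_of_pos s1 (hx_of 1 s1.ne)))
      (neg_neg_of_pos (div_pos s2 (hx_of 2 s2.ne'))) hsum (by linear_combination -hT) (by tauto)
  · have e0 : φ 0 = Real.pi - Real.pi / 18 - 2 * Real.pi := by simp [hφ]; ring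
    have e1 : φ 1 = Real.pi - Real.pi / 6 - 2 * Real.pi := by simp [hφ]; ring
    have e2 : φ 2 = 2 * Real.pi / 9 - 2 * Real.pi := by simp [hφ]; ring
    have c0 : Real.cos (φ 0) = -Real.cos (Real.pi / 18) := by
      rw [e0, Real.cos_sub_two_pi, Real.cos_pi_sub]
    have c1 : Real.cos (φ 1) = -(√3 / 2) := by
      rw [e1, Real.cos_sub_two_pi, Real.cos_pi_sub, Real.cos_pi_div_six]
    have c2 : Real.cos (φ 2) = Real.cos (2 * Real.pi / 9) := by rw [e2, Real.cos_sub_two_pi]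
    have s0 : Real.sin (φ 0) = Real.sin (Real.pi / 18) := by
      rw [e0, Real.sin_sub_two_pi, Real.sin_pi_sub]
    have s1 : Real.sin (φ 1) = 1 / 2 := by
      rw [e1, Real.sin_sub_two_pi, Real.sin_pi_sub, Real.sin_pi_div_six]
    have s2 : Real.sin (φ 2) = Real.sin (2 * Real.pi / 9) := by rw [e2, Real.sin_sub_two_pi]
    have hy : ∀ i, Real.sin (φ i) ≠ 0 := by
      intro i
      fin_cases i
      · exact s0 ▸ (Real.sin_pos_of_pos_of_lt_pi (by positivity) (by linarith)).ne'
      · exact s1 ▸ by norm_num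
      · exact s2 ▸ (Real.sin_pos_of_pos_of_lt_pi (by positivity) (by linarith)).ne'
    obtain ⟨p, q, s, hsum, hT, hc⟩ := main hy
    have hTi := fun i => div_mul_cancel₀ (Real.sin (φ i)) (hx_of i (hy i)).ne'
    have b0 := cot_pi_div_thirty_six_bound
      (T := Real.sin (φ 0) / (1 + Real.cos (φ 0))) (by rw [← c0, hTi, s0])
    have b1 := tan_five_pi_div_twelve_bound
      (T := Real.sin (φ 1) / (1 + Real.cos (φ 1))) (by rw [← c1, hTi, s1])
    have b2 := tan_pi_div_nine_bounds
      (T := Real.sin (φ 2) / (1 + Real.cos (φ 2))) (by rw [← c2, hTi, s2])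
    have hD : Real.cos (2 * Real.pi / 9) < 0.7661 := by
      rw [show 2 * Real.pi / 9 = 2 * (Real.pi / 9) by ring, Real.cos_two_mul]
      nlinarith [cos_pi_div_nine_bounds]
    have hpos_of : ∀ t, 0 < t → t < Real.pi / 2 → 0 < Real.cos t := fun t h1 h2 =>
      Real.cos_pos_of_mem_Ioo ⟨by linarith, h2⟩
    refine not_weighted_loxodromic b0 b1 b2 (Real.cos_le_one (Real.pi / 18))
      (hpos_of _ (by positivity) (by linarith)) hD (hpos_of _ (by positivity) (by linarith))
      hsum hT ?_
    simp only [c0, c1, c2] at hc ⊢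
    exact hc

theorem exp_mul_I_pow_six_ne_one {θ : ℝ} (h : ∀ n : ℤ, θ ≠ n * (Real.pi / 3)) :
    Complex.exp (θ * Complex.I) ^ 6 ≠ 1 := by
  rw [← Complex.exp_nat_mul, Ne, Complex.exp_eq_one_iff]
  rintro ⟨n, hn⟩
  apply h n
  have := congrArg Complex.im hn
  simp at this
  linarith

/-- The regular elliptic isometry with angle pair {13π/18, 11π/18}, given by the
SU(2,1) matrix diag(e^{5πi/18}, e^{πi/6}, e^{−4πi/9}), is not a product of three
holomorphic involutions. -/
theorem not_product_of_three_involutions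
    (I₁ I₂ I₃ : Matrix (Fin 3) (Fin 3) ℂ)
    (h₁ : InU21 I₁ ∧ I₁ * I₁ = 1)
    (h₂ : InU21 I₂ ∧ I₂ * I₂ = 1)
    (h₃ : InU21 I₃ ∧ I₃ * I₃ = 1)
    (c : ℂ) :
    Matrix.diagonal
      ![Complex.exp (5 * Real.pi * Complex.I / 18),
        Complex.exp (Real.pi * Complex.I / 6),
        Complex.exp (-(4 * Real.pi * Complex.I / 9))]
      ≠ c • (I₁ * I₂ * I₃) := by
  intro h
  obtain ⟨s₁, r₁, v₁, hs₁, rfl, hr₁⟩ := exists_invol h₁.1 h₁.2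
  obtain ⟨s₂, r₂, v₂, hs₂, rfl, hr₂⟩ := exists_invol h₂.1 h₂.2
  obtain ⟨s₃, r₃, v₃, hs₃, rfl, hr₃⟩ := exists_invol h₃.1 h₃.2
  set θ : Fin 3 → ℝ := ![5 * Real.pi / 18, Real.pi / 6, -(4 * Real.pi / 9)] with hθ
  have ha : (![Complex.exp (5 * Real.pi * Complex.I / 18), Complex.exp (Real.pi * Complex.I / 6),
      Complex.exp (-(4 * Real.pi * Complex.I / 9))] : Fin 3 → ℂ) =
      fun i => Complex.exp (θ i * Complex.I) := by
    ext i
    fin_cases i <;> simp [hθ] <;> congr 1 <;> ring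
  obtain ⟨d, hd⟩ : ∃ d, d = c * s₁ * s₂ * s₃ := ⟨_, rfl⟩
  have hA : Matrix.diagonal (fun i => Complex.exp (θ i * Complex.I)) =
      d • (invol r₁ v₁ * invol r₂ v₂ * invol r₃ v₃) := by
    rw [← ha, h, hd]
    simp only [smul_mul_assoc, mul_smul_comm, smul_smul]
    congr 1; ring
  have hdet : (1 : ℂ) = d ^ 3 *
      ((invol r₁ v₁).det * (invol r₂ v₂).det * (invol r₃ v₃).det) := by
    have := congrArg Matrix.det hA
    rw [Matrix.det_smul, Matrix.det_mul, Matrix.det_mul, Matrix.det_diagonal,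
      Fin.prod_univ_three, ← Complex.exp_add, ← Complex.exp_add] at this
    rw [show (θ 0 * Complex.I + θ 1 * Complex.I + θ 2 * Complex.I : ℂ) = 0 by
      simp [hθ]; ring, Complex.exp_zero] at this
    simpa using this
  have hsq : ∀ {r : ℝ} {v : Fin 3 → ℂ}, r = 0 ∨ r * hermNorm v = 1 →
      (invol r v).det ^ 2 = 1 := by
    rintro r v (rfl | h)
    · rw [det_invol]; simp
    · rw [det_invol, h]; norm_num
  have hd6 : d ^ 6 = 1 := by
    calc d ^ 6 = d ^ 6 * ((invol r₁ v₁).det ^ 2 * (invol r₂ v₂).det ^ 2 *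
          (invol r₃ v₃).det ^ 2) := by rw [hsq hr₁, hsq hr₂, hsq hr₃]; ring
      _ = (d ^ 3 * ((invol r₁ v₁).det * (invol r₂ v₂).det * (invol r₃ v₃).det)) ^ 2 := by ring
      _ = 1 := by rw [← hdet, one_pow]
  have hθ6 : ∀ i, Complex.exp (θ i * Complex.I) ^ 6 ≠ 1 := by
    intro i
    apply exp_mul_I_pow_six_ne_one
    intro n hn
    have hpi := Real.pi_ne_zero
    fin_cases i
    · have h' : (15 : ℝ) = 18 * n := mul_right_cancel₀ hpi (by simp [hθ] at hn; linarith)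
      have : (15 : ℤ) = 18 * n := by exact_mod_cast h'
      omega
    · have h' : (1 : ℝ) = 2 * n := mul_right_cancel₀ hpi (by simp [hθ] at hn; linarith)
      have : (1 : ℤ) = 2 * n := by exact_mod_cast h'
      omega
    · have h' : (-4 : ℝ) = 3 * n := mul_right_cancel₀ hpi (by simp [hθ] at hn; linarith)
      have : (-4 : ℤ) = 3 * n := by exact_mod_cast h'
      omega
  have two : ∀ {r s : ℝ} {u v : Fin 3 → ℂ}, Matrix.diagonal (fun i =>
      Complex.exp (θ i * Complex.I)) ≠ (-d) • (invol r u * invol s v) := by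
    intro r s u v h
    obtain ⟨i, hi⟩ := diagonal_eq_smul_invol_mul_invol h
    apply hθ6 i
    rw [hi]
    linear_combination hd6
  replace hr₁ := hr₁.resolve_left (by
    rintro rfl
    exact two (r := r₂) (u := v₂) (s := r₃) (v := v₃)
      (by rw [hA, invol_zero]; simp))
  replace hr₂ := hr₂.resolve_left (by
    rintro rfl
    exact two (r := r₁) (u := v₁) (s := r₃) (v := v₃)
      (by rw [hA, invol_zero]; simp))
  replace hr₃ := hr₃.resolve_left (by
    rintro rfl
    exact two (r := r₁) (u := v₁) (s := r₂) (v := v₂)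
      (by rw [hA, invol_zero]; simp))
  have hd3 : d ^ 3 = 1 := by
    rw [det_invol, det_invol, det_invol, hr₁, hr₂, hr₃] at hdet
    norm_num at hdet
    exact hdet.symm
  obtain ⟨k, hk, hkd⟩ := (Complex.isPrimitiveRoot_exp 3 (by norm_num)).eq_pow_of_pow_eq_one hd3
  have hdγ : d = Complex.exp ((2 * Real.pi * k / 3 : ℝ) * Complex.I) := by
    rw [← hkd, ← Complex.exp_nat_mul]
    congr 1
    push_cast
    ring
  apply not_diagonal_eq_invol_prod (γ := 2 * Real.pi * k / 3) hr₁ hr₂ hr₃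
  · interval_cases k
    · left; simp
    · right; left; simp
    · right; right; push_cast; ring
  · have hd0 : d ≠ 0 := by rintro rfl; norm_num at hd3
    have hinv := congrArg (d⁻¹ • ·) hA
    simp only [smul_smul, inv_mul_cancel₀ hd0, one_smul] at hinv
    rw [← hinv, ← Matrix.diagonal_smul]
    congr 1
    ext i
    rw [Pi.smul_apply, smul_eq_mul, hdγ, ← Complex.exp_neg, ← Complex.exp_add]
    congr 1
    push_cast
    ring
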